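/- arXiv:1707.06771 — 3 statements merged into one kernel-verified Lean document; each statement's English description precedes it below -/
import Mathlib

section
/- The series Σ_{n=1}^∞ 4^n / (n^2 · C(2n,n) · H-free) with H_{n-1} the (n-1)st harmonic number satisfies Σ_{n=1}^∞ (2^{2n}/C(2n,n)) · H_{n-1}/n^2 = 7 ζ(3). -/
/-- Harmonic number `H_n = ∑_{j=1}^n 1/j` (with `H_0 = 0`). -/
noncomputable def harmonicNum (n : ℕ) : ℝ := ∑ j ∈ Finset.Icc 1 n, 1 / (j : ℝ)

open Filter Topology in
theorem hasSum_telescope (f G : ℕ → ℝ) (a : ℝ) (h : ∀ n, f n = G n - G (n+1)) (hf : ∀ n, 0 ≤ f n)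
    (h0 : G 0 = a) (hG : Tendsto G atTop (𝓝 0)) : HasSum f a := by
  rw [hasSum_iff_tendsto_nat_of_nonneg hf]
  have : (fun n => ∑ i ∈ Finset.range n, f i) = fun n => a - G n := by
    funext n
    induction n with
    | zero => simp [h0]
    | succ k ih => rw [Finset.sum_range_succ, ih, h]; ring
  rw [this]
  simpa using hG.const_sub a

noncomputable def BB : ℕ → ℝ → ℝ
  | 0, y => 1 / y
  | (n+1), y => BB n y * ((n:ℝ)+1) / (y + n + 1)

theorem BB_pos (n : ℕ) (y : ℝ) (hy : 0 < y) : 0 < BB n y := by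
  induction n with
  | zero => simpa [BB] using hy
  | succ n ih => rw [BB]; positivity

theorem BB_le (n : ℕ) (y : ℝ) (hy : 0 < y) : BB n y ≤ 1 / y := by
  induction n with
  | zero => simp [BB]
  | succ n ih =>
    rw [BB]
    have := BB_pos n y hy
    refine le_trans ?_ ih
    rw [div_le_iff₀ (by positivity)]
    nlinarith

theorem BB_shift (n : ℕ) (y : ℝ) (hy : 0 < y) : BB n (y+1) = BB n y * y / (y + n + 1) := by
  induction n with
  | zero => simp [BB]; field_simp
  | succ n ih =>
    rw [BB, BB, ih]
    push_cast
    have : y + 1 + n + 1 ≠ 0 := by positivity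
    have : y + (n + 1) + 1 ≠ 0 := by positivity
    have : y + n + 1 ≠ 0 := by positivity
    field_simp
    ring

theorem BB_sq (n : ℕ) (y : ℝ) (hy : 1/2 ≤ y) : BB n y ^ 2 * (n+1) ≤ 4 := by
  induction n with
  | zero =>
    have : 1 / y ≤ 2 := by rw [div_le_iff₀ (by linarith)]; linarith
    have h2 : 0 < 1 / y := by positivity
    simp only [BB]; push_cast; nlinarith
  | succ n ih =>
    refine le_trans ?_ ih
    rw [BB, div_pow, mul_pow]
    push_cast
    rw [div_mul_eq_mul_div, div_le_iff₀ (by positivity), mul_assoc, mul_assoc]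
    apply mul_le_mul_of_nonneg_left _ (sq_nonneg _)
    have hn : (0:ℝ) ≤ n := n.cast_nonneg
    have : (n + 3/2 : ℝ)^2 ≤ (y + n + 1)^2 := by
      apply pow_le_pow_left₀ <;> linarith
    nlinarith

theorem hN_nonneg (n : ℕ) : 0 ≤ harmonicNum n := by
  unfold harmonicNum; positivity

theorem hN_succ (n : ℕ) : harmonicNum (n+1) = harmonicNum n + 1 / ((n:ℝ)+1) := by
  unfold harmonicNum
  rw [Finset.sum_Icc_succ_top (by omega)]; push_cast; rfl

theorem hN_le (n : ℕ) : harmonicNum n ≤ 1 + Real.log (n+1) := by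
  have h := harmonic_le_one_add_log n
  have e : ((harmonic n : ℚ) : ℝ) = harmonicNum n := by
    rw [harmonic_eq_sum_Icc]; unfold harmonicNum; push_cast; simp
  rw [e] at h
  refine h.trans ?_
  rcases Nat.eq_zero_or_pos n with h0 | h0
  · simp [h0]
  · have : (0:ℝ) < n := by exact_mod_cast h0
    have := Real.log_le_log this (by linarith : (n:ℝ) ≤ n+1)
    linarith

theorem BB_le' (n : ℕ) (y : ℝ) (hy : 1/2 ≤ y) : BB n y ≤ 2 / Real.sqrt (n+1) := by
  have hs : 0 < Real.sqrt ((n:ℝ)+1) := by positivity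
  rw [le_div_iff₀ hs]
  have h := BB_sq n y hy
  have : (BB n y * Real.sqrt (n+1))^2 ≤ 2^2 := by
    rw [mul_pow, Real.sq_sqrt (by positivity)]; linarith
  exact le_of_sq_le_sq this (by norm_num)

open Filter Topology in
theorem hB_tendsto (y : ℝ) (hy : 1/2 ≤ y) :
    Tendsto (fun n : ℕ => (harmonicNum n + 1 / y) * BB n y / y) atTop (𝓝 0) := by
  have hy0 : 0 < y := by linarith
  have h1 : Tendsto (fun x : ℝ => Real.log x / Real.sqrt x) atTop (𝓝 0) := by
    have := (isLittleO_log_rpow_atTop (r := 1/2) (by norm_num)).tendsto_div_nhds_zero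
    simpa [Real.sqrt_eq_rpow] using this
  have h2 : Tendsto (fun x : ℝ => (1 + 1/y) / Real.sqrt x) atTop (𝓝 0) :=
    Tendsto.div_atTop tendsto_const_nhds Real.tendsto_sqrt_atTop
  have h3 : Tendsto (fun n : ℕ => (n:ℝ)+1) atTop atTop :=
    tendsto_atTop_add_const_right _ _ tendsto_natCast_atTop_atTop
  have h4 := (((h1.add h2).comp h3).mul_const (2 / y))
  simp only [add_zero, zero_mul] at h4
  refine squeeze_zero (fun n => ?_) (fun n => ?_) h4
  · have := hN_nonneg n
    have := BB_pos n y hy0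
    positivity
  · have a := hN_le n
    have b := BB_le' n y hy
    have := BB_pos n y hy0
    have := hN_nonneg n
    have hs : 0 < Real.sqrt ((n:ℝ)+1) := by positivity
    calc (harmonicNum n + 1 / y) * BB n y / y
        ≤ ((1 + Real.log (n+1)) + 1 / y) * (2 / Real.sqrt (n+1)) / y := by
          have hl : 0 ≤ 1 + Real.log (n+1) := by linarith
          have hl2 : 0 ≤ 1 + Real.log (n+1) + 1 / y := by positivity
          gcongr
      _ = _ := by simp only [Function.comp]; field_simp; ring

theorem sum_n (y : ℝ) (hy : 1/2 ≤ y) :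
    HasSum (fun n : ℕ => harmonicNum n * BB (n+1) y / ((n:ℝ)+1)) (1 / y^3) := by
  have hy0 : 0 < y := by linarith
  refine hasSum_telescope _ (fun n : ℕ => (harmonicNum n + 1 / y) * BB n y / y) _ ?_ ?_ ?_
    (hB_tendsto y hy)
  · intro n
    simp only [hN_succ, BB]
    have : y + n + 1 ≠ 0 := by positivity
    field_simp
    ring
  · intro n
    have := BB_pos (n+1) y hy0
    have := hN_nonneg n
    positivity
  · simp [BB, harmonicNum]; field_simp

open Filter Topology in
theorem sum_m (n : ℕ) : HasSum (fun m : ℕ => BB (n+1) ((m:ℝ)+1/2)) (BB n (1/2)) := by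
  refine hasSum_telescope _ (fun m : ℕ => BB n ((m:ℝ)+1/2)) _ ?_ ?_ ?_ ?_
  · intro m
    have h : ((m+1:ℕ):ℝ)+1/2 = ((m:ℝ)+1/2)+1 := by push_cast; ring
    simp only [h]
    rw [BB_shift _ _ (by positivity), BB]
    have : (m:ℝ)+1/2 + n + 1 ≠ 0 := by positivity
    field_simp
    ring
  · intro m; exact (BB_pos _ _ (by positivity)).le
  · simp
  · refine squeeze_zero (fun m => (BB_pos _ _ (by positivity)).le)
      (fun m => BB_le _ _ (by positivity)) ?_
    exact Tendsto.div_atTop tendsto_const_nhds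
      (tendsto_atTop_add_const_right _ _ tendsto_natCast_atTop_atTop)

theorem BB_half (n : ℕ) : BB n (1/2) =
    (2 : ℝ) ^ (2 * (n + 1)) / (Nat.choose (2 * (n + 1)) (n + 1)) / ((n : ℝ) + 1) := by
  induction n with
  | zero => norm_num [BB]
  | succ n ih =>
    rw [BB, ih]
    have h := Nat.succ_mul_centralBinom_succ (n+1)
    simp only [Nat.centralBinom] at h
    have h' : ((n:ℝ)+1+1) * (Nat.choose (2*(n+1+1)) (n+1+1)) =
        2 * (2*(n+1)+1) * (Nat.choose (2*(n+1)) (n+1)) := by exact_mod_cast h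
    have p1 : (0:ℝ) < Nat.choose (2*(n+1)) (n+1) := by
      exact_mod_cast Nat.choose_pos (by omega)
    have p2 : (0:ℝ) < Nat.choose (2*(n+1+1)) (n+1+1) := by
      exact_mod_cast Nat.choose_pos (by omega)
    have e : (2:ℝ)^(2*(n+1+1)) = 4 * 2^(2*(n+1)) := by
      rw [show 2*(n+1+1) = 2*(n+1)+2 by ring, pow_add]; ring
    push_cast
    rw [e, div_div _ _ ((n:ℝ)+1+1), mul_comm (Nat.choose (2*(n+1+1)) (n+1+1) : ℝ), h']
    have : (1:ℝ)/2 + n + 1 ≠ 0 := by positivity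
    field_simp
    ring

theorem zeta_odd : Summable (fun m : ℕ => 1 / ((m:ℝ)+1/2)^3) ∧
    ((∑' m : ℕ, 1 / ((m:ℝ)+1/2)^3 : ℝ) : ℂ) = 7 * riemannZeta 3 := by
  have hz : riemannZeta 3 = ((∑' n : ℕ, 1 / (n:ℝ)^3 : ℝ) : ℂ) := by
    have := zeta_nat_eq_tsum_of_gt_one (k := 3) (by norm_num)
    push_cast at this ⊢
    exact this
  have hs : Summable (fun n : ℕ => 1 / (n:ℝ)^3) :=
    Real.summable_one_div_nat_pow.mpr (by norm_num)
  have he : Summable (fun k : ℕ => 1 / ((2*k:ℕ):ℝ)^3) :=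
    hs.comp_injective (i := fun k : ℕ => 2*k) (fun a b h => by simpa using h)
  have ho : Summable (fun k : ℕ => 1 / ((2*k+1:ℕ):ℝ)^3) :=
    hs.comp_injective (i := fun k : ℕ => 2*k+1) (fun a b h => by simpa using h)
  have h := tsum_even_add_odd (f := fun n : ℕ => 1 / (n:ℝ)^3) he ho
  have e1 : (fun k : ℕ => 1 / ((2*k:ℕ):ℝ)^3) = fun k : ℕ => (1/8) * (1 / (k:ℝ)^3) := by
    funext k; push_cast; rw [mul_pow]; ring
  have e2 : (fun m : ℕ => 1 / ((m:ℝ)+1/2)^3) = fun k : ℕ => 8 * (1 / ((2*k+1:ℕ):ℝ)^3) := by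
    funext k; push_cast
    have : (2:ℝ)*k+1 ≠ 0 := by positivity
    have h2 : (k:ℝ)+1/2 = (2*k+1)/2 := by ring
    rw [h2]; field_simp; norm_num
  rw [e2, hz]
  refine ⟨ho.mul_left 8, ?_⟩
  rw [e1, tsum_mul_left] at h
  rw [tsum_mul_left]
  have : 8 * (∑' k : ℕ, 1 / ((2*k+1:ℕ):ℝ)^3) = 7 * ∑' n : ℕ, 1 / (n:ℝ)^3 := by linarith
  rw [this]; push_cast; rfl

theorem sum_central_binom_harmonic_eq_seven_zeta_three :
    ((∑' n : ℕ, (2 : ℝ) ^ (2 * (n + 1)) / (Nat.choose (2 * (n + 1)) (n + 1)) *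
        harmonicNum n / ((n : ℝ) + 1) ^ 2 : ℝ) : ℂ) = 7 * riemannZeta 3 := by
  obtain ⟨hs, hv⟩ := zeta_odd
  rw [← hv]
  congr 1
  have hy : ∀ m : ℕ, (1:ℝ)/2 ≤ (m:ℝ)+1/2 := fun m => by
    have : (0:ℝ) ≤ m := m.cast_nonneg
    linarith
  let F : ℕ → ℕ → ℝ := fun m n => harmonicNum n * BB (n+1) ((m:ℝ)+1/2) / ((n:ℝ)+1)
  have hF : Summable (Function.uncurry F) := by
    rw [summable_prod_of_nonneg]
    · refine ⟨fun m => (sum_n _ (hy m)).summable, ?_⟩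
      refine hs.congr fun m => ?_
      exact (sum_n _ (hy m)).tsum_eq.symm
    · rintro ⟨m, n⟩
      have := BB_pos (n+1) ((m:ℝ)+1/2) (by positivity)
      have := hN_nonneg n
      simp only [Function.uncurry, F, Pi.zero_apply]
      positivity
  have hc := hF.tsum_comm
  have l : ∀ m, ∑' n, F m n = 1 / ((m:ℝ)+1/2)^3 := fun m => (sum_n _ (hy m)).tsum_eq
  have r : ∀ n : ℕ, ∑' m, F m n = (2 : ℝ) ^ (2 * (n + 1)) / (Nat.choose (2 * (n + 1)) (n + 1)) *
        harmonicNum n / ((n : ℝ) + 1) ^ 2 := fun n => by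
    have := ((sum_m n).mul_left (harmonicNum n)).div_const ((n:ℝ)+1)
    rw [this.tsum_eq, BB_half]
    have : (0:ℝ) < Nat.choose (2*(n+1)) (n+1) := by
      exact_mod_cast Nat.choose_pos (by omega)
    field_simp
  simp only [l, r] at hc
  first | exact hc | exact hc.symm
end

section
/- Σ_{n=1}^∞ (2^{2n}/C(2n,n)) · O_n / n^2 = 7 ζ(3), where O_n = Σ_{k=1}^n 1/(2k-1). -/
/-- Odd harmonic number `O_n = ∑_{k=1}^n 1/(2k-1)`. -/
noncomputable def oddHarmonic (n : ℕ) : ℝ := ∑ k ∈ Finset.Icc 1 n, 1 / (2 * (k : ℝ) - 1)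

open Filter Topology

noncomputable def bb (s : ℝ) : ℕ → ℝ
  | 0 => 1 / s
  | (n+1) => bb s n * (n + 1) / (s + n + 1)

noncomputable def hh (s : ℝ) : ℕ → ℝ
  | 0 => 1 / s
  | (n+1) => hh s n + 1 / (s + n + 1)

noncomputable def DD (s : ℝ) (n : ℕ) : ℝ := bb s n * hh s n / 2

noncomputable def EE (s : ℝ) (n : ℕ) : ℝ := DD s n / s + bb s n / (2 * s ^ 2)

theorem bb_pos {s : ℝ} (hs : 0 < s) (n : ℕ) : 0 < bb s n := by
  induction n with
  | zero => simp only [bb]; positivity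
  | succ n ih => simp only [bb]; positivity

theorem hh_ge {s : ℝ} (hs : 0 < s) (n : ℕ) : 1 / s ≤ hh s n := by
  induction n with
  | zero => simp only [hh]; exact le_rfl
  | succ n ih =>
    simp only [hh]
    have : 0 < 1 / (s + n + 1) := by positivity
    linarith

theorem hh_pos {s : ℝ} (hs : 0 < s) (n : ℕ) : 0 < hh s n :=
  lt_of_lt_of_le (by positivity) (hh_ge hs n)

theorem DD_pos {s : ℝ} (hs : 0 < s) (n : ℕ) : 0 < DD s n := by
  have := bb_pos hs n
  have := hh_pos hs n
  unfold DD; positivity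

theorem EE_pos {s : ℝ} (hs : 0 < s) (n : ℕ) : 0 < EE s n := by
  have := bb_pos hs n
  have := DD_pos hs n
  unfold EE; positivity

theorem bb_shift {s : ℝ} (hs : 0 < s) (n : ℕ) : bb (s+1) n = bb s n * s / (s + n + 1) := by
  induction n with
  | zero => simp only [bb]; push_cast; field_simp; try ring
  | succ n ih =>
    simp only [bb]; rw [ih]; push_cast
    have h1 : s + n + 1 ≠ 0 := by positivity
    have h2 : s + 1 + n + 1 ≠ 0 := by positivity
    have h3 : s + (n + 1) + 1 ≠ 0 := by positivity
    field_simp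
    try ring

theorem hh_shift {s : ℝ} (hs : 0 < s) (n : ℕ) :
    hh (s+1) n = hh s n - 1 / s + 1 / (s + n + 1) := by
  induction n with
  | zero => simp only [hh]; push_cast; simp
  | succ n ih =>
    simp only [hh]; rw [ih]; push_cast
    rw [show s + 1 + (n:ℝ) + 1 = s + (n + 1) + 1 by ring]
    ring

theorem DD_shift {s : ℝ} (hs : 0 < s) (n : ℕ) : DD s n - DD (s+1) n = DD s (n+1) := by
  unfold DD
  rw [bb_shift hs, hh_shift hs]
  simp only [bb, hh]
  have h1 : s + n + 1 ≠ 0 := by positivity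
  field_simp
  ring

theorem EE_tel {s : ℝ} (hs : 0 < s) (n : ℕ) :
    EE s n - EE s (n+1) = DD s (n+1) / (n + 1) := by
  unfold EE DD
  simp only [bb, hh]
  have h1 : s + n + 1 ≠ 0 := by positivity
  have h2 : (n:ℝ) + 1 ≠ 0 := by positivity
  field_simp
  ring

theorem EE_zero {s : ℝ} (hs : 0 < s) : EE s 0 = 1 / s ^ 3 := by
  simp only [EE, DD, bb, hh]
  field_simp
  try ring

theorem EE_le {s : ℝ} (hs : 0 < s) (n : ℕ) : s / 2 * EE s n ≤ DD s n := by
  have h := mul_le_mul_of_nonneg_left (hh_ge hs n) (bb_pos hs n).le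
  have : s / 2 * EE s n = DD s n / 2 + (bb s n * (1 / s)) / 4 := by
    unfold EE; field_simp; ring
  rw [this]
  unfold DD
  linarith

theorem EE_tendsto {s : ℝ} (hs : 0 < s) : Tendsto (EE s) atTop (𝓝 0) := by
  have hanti : Antitone (EE s) := antitone_nat_of_succ_le fun n => by
    have h := EE_tel hs n
    have : 0 < DD s (n+1) / (n+1) := div_pos (DD_pos hs _) (by positivity)
    linarith
  have hbdd : BddBelow (Set.range (EE s)) := ⟨0, by rintro _ ⟨n, rfl⟩; exact (EE_pos hs n).le⟩
  have hlim := tendsto_atTop_ciInf hanti hbdd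
  set L := ⨅ n, EE s n with hL
  have hL0 : 0 ≤ L := le_ciInf fun n => (EE_pos hs n).le
  rcases hL0.eq_or_lt with h | h
  · rw [← h] at hlim; exact hlim
  exfalso
  have hle : ∀ n, L ≤ EE s n := fun n => ciInf_le hbdd n
  have hsum : Summable (fun n : ℕ => DD s (n+1) / ((n:ℝ) + 1)) := by
    refine summable_of_sum_range_le (c := EE s 0) (fun n => (div_pos (DD_pos hs _) (by positivity)).le) ?_
    intro n
    have : ∑ i ∈ Finset.range n, DD s (i+1) / ((i:ℝ) + 1) = EE s 0 - EE s n := by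
      rw [← Finset.sum_range_sub']
      exact Finset.sum_congr rfl fun i _ => (EE_tel hs i).symm
    rw [this]
    linarith [EE_pos hs n]
  have h2 : Summable (fun n : ℕ => s / 2 * L * (1 / ((n:ℝ) + 1))) := by
    refine Summable.of_nonneg_of_le (fun n => by positivity) (fun n => ?_) hsum
    rw [mul_one_div]
    gcongr
    exact le_trans (mul_le_mul_of_nonneg_left (hle (n+1)) (by positivity)) (EE_le hs (n+1))
  rw [summable_mul_left_iff (by positivity)] at h2
  have h3 := (summable_nat_add_iff (f := fun n : ℕ => 1 / (n:ℝ)) 1).1 (by simpa using h2)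
  exact Real.not_summable_one_div_natCast h3

theorem hasSum_col {s : ℝ} (hs : 0 < s) :
    HasSum (fun n : ℕ => DD s (n+1) / ((n:ℝ) + 1)) (1 / s ^ 3) := by
  rw [hasSum_iff_tendsto_nat_of_nonneg (fun n => (div_pos (DD_pos hs _) (by positivity)).le)]
  have : ∀ n, ∑ i ∈ Finset.range n, DD s (i+1) / ((i:ℝ) + 1) = EE s 0 - EE s n := fun n => by
    rw [← Finset.sum_range_sub']
    exact Finset.sum_congr rfl fun i _ => (EE_tel hs i).symm
  simp_rw [this, EE_zero hs]
  have h := (EE_tendsto hs).const_sub (1 / s ^ 3)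
  rwa [sub_zero] at h

theorem bb_le {s : ℝ} (hs : 0 < s) (n : ℕ) : bb s n ≤ 1 / s := by
  induction n with
  | zero => simp [bb]
  | succ n ih =>
    simp only [bb]
    refine le_trans ?_ ih
    rw [div_le_iff₀ (by positivity)]
    have := bb_pos hs n
    gcongr
    linarith

theorem hh_le {s : ℝ} (hs : 0 < s) (n : ℕ) : hh s n ≤ (n + 1) * (1 / s) := by
  induction n with
  | zero => simp [hh]
  | succ n ih =>
    simp only [hh]
    have : 1 / (s + n + 1) ≤ 1 / s := by
      apply one_div_le_one_div_of_le hs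
      have : (0:ℝ) ≤ n := by positivity
      linarith
    push_cast
    linarith

theorem DD_tendsto {s : ℝ} (hs : 0 < s) (n : ℕ) :
    Tendsto (fun k : ℕ => DD (s + k) n) atTop (𝓝 0) := by
  have h1 : Tendsto (fun k : ℕ => 1 / (s + (k:ℝ))) atTop (𝓝 0) := by
    simp_rw [one_div]
    exact (tendsto_atTop_add_const_left _ s tendsto_natCast_atTop_atTop).inv_tendsto_atTop
  have h2 : Tendsto (fun k : ℕ => 1 / (s + (k:ℝ)) * ((n + 1) * (1 / (s + (k:ℝ)))) / 2) atTop (𝓝 0) := by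
    simpa using (h1.mul (h1.const_mul ((n:ℝ) + 1))).div_const 2
  refine squeeze_zero (fun k => (DD_pos (by positivity) n).le) (fun k => ?_) h2
  have hk : 0 < s + (k:ℝ) := by positivity
  unfold DD
  have := hh_pos hk n
  have := bb_le hk n
  have := hh_le hk n
  gcongr

theorem hasSum_row {s : ℝ} (hs : 0 < s) (n : ℕ) :
    HasSum (fun k : ℕ => DD (s + k) (n+1) / ((n:ℝ) + 1)) (DD s n / (n + 1)) := by
  apply HasSum.div_const
  rw [hasSum_iff_tendsto_nat_of_nonneg (fun k => (DD_pos (by positivity) _).le)]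
  have : ∀ m, ∑ k ∈ Finset.range m, DD (s + k) (n+1) = DD s n - DD (s + m) n := fun m => by
    have h := Finset.sum_range_sub' (fun k : ℕ => DD (s + k) n) m
    simp only [Nat.cast_zero, add_zero] at h
    rw [← h]
    refine Finset.sum_congr rfl fun k _ => ?_
    rw [← DD_shift (by positivity)]
    push_cast
    rw [add_assoc]
  simp_rw [this]
  simpa using (DD_tendsto hs n).const_sub (DD s n)

theorem summable_half : Summable (fun k : ℕ => 1 / ((1/2 : ℝ) + k) ^ 3) := by
  have h := (Real.summable_one_div_nat_pow (p := 3)).2 (by norm_num)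
  have h2 := (h.comp_injective (i := fun k : ℕ => 2 * k + 1) (fun a b hab => by simpa using hab)).mul_left 8
  refine h2.congr fun k => ?_
  simp only [Function.comp]
  push_cast
  field_simp
  ring

theorem main_swap : ∑' n : ℕ, DD (1/2) n / ((n:ℝ) + 1) = ∑' k : ℕ, 1 / ((1/2 : ℝ) + k) ^ 3 := by
  have hp : ∀ k : ℕ, 0 < (1/2:ℝ) + k := fun k => by positivity
  have hs : Summable (fun p : ℕ × ℕ => DD ((1/2:ℝ) + p.1) (p.2+1) / ((p.2:ℝ) + 1)) := by
    rw [summable_prod_of_nonneg (fun p => (div_pos (DD_pos (hp p.1) _) (by positivity)).le)]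
    refine ⟨fun k => (hasSum_col (hp k)).summable, ?_⟩
    refine summable_half.congr fun k => ?_
    exact (hasSum_col (hp k)).tsum_eq.symm
  have h := Summable.tsum_comm (f := fun (k n : ℕ) => DD ((1/2:ℝ) + k) (n+1) / ((n:ℝ) + 1)) hs
  calc _ = ∑' n : ℕ, ∑' k : ℕ, DD ((1/2:ℝ) + k) (n+1) / ((n:ℝ) + 1) :=
        tsum_congr fun n => (hasSum_row (by norm_num) n).tsum_eq.symm
    _ = _ := h
    _ = _ := tsum_congr fun k => (hasSum_col (hp k)).tsum_eq

theorem hh_half (n : ℕ) : hh (1/2) n = 2 * oddHarmonic (n+1) := by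
  induction n with
  | zero => simp [hh, oddHarmonic]; norm_num
  | succ n ih =>
    have h : oddHarmonic (n+1+1) = oddHarmonic (n+1) + 1 / (2 * ((n+1+1 : ℕ):ℝ) - 1) := by
      unfold oddHarmonic
      rw [Finset.sum_Icc_succ_top (by omega)]
    simp only [hh]
    rw [h, ih, mul_add]
    push_cast
    congr 1
    rw [show 2 * ((n:ℝ) + 1 + 1) - 1 = 2 * (1/2 + n + 1) by ring]
    field_simp

theorem bb_half (n : ℕ) :
    bb (1/2) n = 2 ^ (2 * (n+1)) / (Nat.choose (2 * (n+1)) (n+1)) / ((n:ℝ) + 1) := by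
  change _ = 2 ^ (2 * (n+1)) / (Nat.centralBinom (n+1) : ℝ) / ((n:ℝ) + 1)
  induction n with
  | zero => simp [bb, Nat.centralBinom]; norm_num [Nat.choose]
  | succ n ih =>
    simp only [bb]
    rw [ih]
    have h := Nat.succ_mul_centralBinom_succ (n+1)
    have h' : ((n:ℝ) + 1 + 1) * (Nat.centralBinom (n+1+1) : ℝ)
        = 2 * (2 * (n + 1) + 1) * (Nat.centralBinom (n+1) : ℝ) := by exact_mod_cast h
    have p1 : (0:ℝ) < Nat.centralBinom (n+1) := by exact_mod_cast Nat.centralBinom_pos _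
    have p2 : (0:ℝ) < Nat.centralBinom (n+1+1) := by exact_mod_cast Nat.centralBinom_pos _
    have e : (Nat.centralBinom (n+1+1) : ℝ) = 2 * (2 * (n + 1) + 1) * (Nat.centralBinom (n+1) : ℝ) / ((n:ℝ) + 1 + 1) := by
      field_simp; linarith
    rw [e]
    push_cast
    have q : (1/2 : ℝ) + n + 1 ≠ 0 := by positivity
    rw [show 2 * (n + 1 + 1) = 2 * (n+1) + 2 by ring, pow_add]
    field_simp
    ring

theorem zeta_half : ((∑' k : ℕ, 1 / ((1/2 : ℝ) + k) ^ 3 : ℝ) : ℂ) = 7 * riemannZeta 3 := by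
  have hz : riemannZeta 3 = ((∑' n : ℕ, 1 / (n:ℝ) ^ 3 : ℝ) : ℂ) := by
    have := zeta_nat_eq_tsum_of_gt_one (k := 3) (by norm_num)
    push_cast at this ⊢
    exact this
  rw [hz]
  have h := (Real.summable_one_div_nat_pow (p := 3)).2 (by norm_num)
  have he := h.comp_injective (i := fun k : ℕ => 2 * k) (fun a b hab => by simpa using hab)
  have ho := h.comp_injective (i := fun k : ℕ => 2 * k + 1) (fun a b hab => by simpa using hab)
  have h1 := tsum_even_add_odd (f := fun n : ℕ => 1 / (n:ℝ) ^ 3) he ho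
  have h2 : ∑' k : ℕ, 1 / ((2 * k : ℕ):ℝ) ^ 3 = 1 / 8 * ∑' n : ℕ, 1 / (n:ℝ) ^ 3 := by
    rw [← tsum_mul_left]
    refine tsum_congr fun k => ?_
    push_cast
    rw [mul_pow, one_div_mul_one_div]
    norm_num
  have h3 : ∑' k : ℕ, 1 / ((1/2 : ℝ) + k) ^ 3 = 8 * ∑' k : ℕ, 1 / ((2 * k + 1 : ℕ):ℝ) ^ 3 := by
    rw [← tsum_mul_left]
    refine tsum_congr fun k => ?_
    push_cast
    field_simp
    ring
  have h4 : ∑' k : ℕ, 1 / ((1/2 : ℝ) + k) ^ 3 = 7 * ∑' n : ℕ, 1 / (n:ℝ) ^ 3 := by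
    rw [h3]; linarith
  rw [h4]
  push_cast
  rfl

theorem sum_central_binom_oddHarmonic_eq_seven_zeta_three :
    ((∑' n : ℕ, (2 : ℝ) ^ (2 * (n + 1)) / (Nat.choose (2 * (n + 1)) (n + 1)) *
        oddHarmonic (n + 1) / ((n : ℝ) + 1) ^ 2 : ℝ) : ℂ) = 7 * riemannZeta 3 := by
  rw [← zeta_half, ← main_swap]
  congr 1
  refine tsum_congr fun n => ?_
  unfold DD
  rw [hh_half, bb_half]
  field_simp
end

section
/- For every positive integer q, Σ_{n=1}^∞ 2^{2n} / (C(2n,n) (2n)^{q+1}) = t({1}^{q-1}, 2), where t(s_1,...,s_q) = Σ_{1≤n_1<...<n_q} Π_j (2n_j - 1)^{-s_j} is the multiple t-value with q-1 leading entries equal to 1 and final entry 2. -/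
/-- The multiple t-value `t(s_1,…,s_q) = ∑_{1 ≤ n_1 < ⋯ < n_q} ∏_j (2n_j - 1)^{-s_j}`. -/
noncomputable def multipleT (q : ℕ) (s : Fin q → ℕ) : ℝ :=
  ∑' f : {f : Fin q → ℕ // StrictMono f ∧ ∀ j, 1 ≤ f j},
    ∏ j, 1 / (2 * (f.1 j : ℝ) - 1) ^ (s j)

open Filter Topology in
lemma tele (u : ℕ → ℝ) (hu : ∀ i, u (i+1) ≤ u i) (h0 : Tendsto u atTop (𝓝 0)) :
    ∑' i, ENNReal.ofReal (u i - u (i+1)) = ENNReal.ofReal (u 0) := by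
  have hs : HasSum (fun i => u i - u (i+1)) (u 0) := by
    rw [hasSum_iff_tendsto_nat_of_nonneg (fun i => sub_nonneg.2 (hu i))]
    simp only [Finset.sum_range_sub']
    simpa using tendsto_const_nhds.sub h0
  rw [← ENNReal.ofReal_tsum_of_nonneg (fun i => sub_nonneg.2 (hu i)) hs.summable, hs.tsum_eq]

/-- The connector. -/
noncomputable def conn (m y : ℕ) : ℝ :=
  ∏ k ∈ Finset.range y, (2 * ((k : ℝ) + 1)) / (2 * k + 2 * m + 1)

lemma conn_pos (m y : ℕ) : 0 < conn m y := by
  unfold conn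
  exact Finset.prod_pos fun k _ => by positivity

lemma conn_zero (m : ℕ) : conn m 0 = 1 := by simp [conn]

lemma conn_succ (m y : ℕ) :
    conn m (y+1) = conn m y * ((2 * ((y : ℝ) + 1)) / (2 * y + 2 * m + 1)) := by
  unfold conn
  rw [Finset.prod_range_succ]

lemma conn_succ_left (m y : ℕ) :
    conn (m+1) y = conn m y * ((2 * (m : ℝ) + 1) / (2 * y + 2 * m + 1)) := by
  induction y with
  | zero => simp [conn_zero]; field_simp
  | succ y ih =>
    rw [conn_succ, conn_succ, ih]
    push_cast
    field_simp
    ring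

lemma conn_sq_le (m y : ℕ) : conn (m+1) y ^ 2 ≤ 1 / ((y : ℝ) + 1) := by
  induction y with
  | zero => simp [conn_zero]
  | succ y ih =>
    rw [conn_succ, mul_pow]
    have h : ((2 * ((y : ℝ) + 1)) / (2 * y + 2 * (m+1 : ℕ) + 1))^2 ≤ (y+1)/(y+2) := by
      rw [div_pow, div_le_div_iff₀ (by positivity) (by positivity)]
      push_cast
      have hm : (0:ℝ) ≤ m := by positivity
      have hy : (0:ℝ) ≤ y := by positivity
      have : 0 ≤ (y+1) * ((2 * (y:ℝ) + 2 * (m+1) + 1)^2 - (2*y+3)^2) := by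
        have : (2 * (y:ℝ) + 2 * (m+1) + 1)^2 - (2*y+3)^2 = 2*m*(4*y+6+2*m) := by ring
        rw [this]; positivity
      nlinarith
    calc _ ≤ 1 / ((y : ℝ) + 1) * ((y+1)/(y+2)) := by gcongr
      _ = _ := by push_cast; field_simp; ring

lemma conn_le (m y : ℕ) : conn (m+1) (y+1) ≤ 1 / ((m : ℝ) + 1) := by
  induction y with
  | zero =>
    rw [conn_succ, conn_zero, one_mul, div_le_div_iff₀ (by positivity) (by positivity)]
    push_cast
    linarith
  | succ y ih =>
    rw [conn_succ]
    refine le_trans (mul_le_of_le_one_right (conn_pos _ _).le ?_) ih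
    rw [div_le_one (by positivity)]
    push_cast
    have hm : (0:ℝ) ≤ m := by positivity
    linarith

open Filter Topology in
lemma conn_tendsto_right (m : ℕ) : Tendsto (fun y => conn (m+1) y) atTop (𝓝 0) := by
  have h : Tendsto (fun y => conn (m+1) y ^ 2) atTop (𝓝 0) :=
    squeeze_zero (fun y => sq_nonneg _) (conn_sq_le m) tendsto_one_div_add_atTop_nhds_zero_nat
  have h2 := h.sqrt
  simpa [Real.sqrt_sq (conn_pos _ _).le] using h2

open Filter Topology in
lemma conn_tendsto_left (y : ℕ) : Tendsto (fun m => conn m (y+1)) atTop (𝓝 0) := by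
  rw [← tendsto_add_atTop_iff_nat 1]
  exact squeeze_zero (fun m => (conn_pos _ _).le) (fun m => conn_le m y)
    tendsto_one_div_add_atTop_nhds_zero_nat

lemma sumA (m : ℕ) (hm : 1 ≤ m) :
    ∑' y : ℕ, ENNReal.ofReal (conn m (y+1) * (1 / (2 * ((y : ℝ) + 1)))) =
      ENNReal.ofReal (1 / (2 * (m : ℝ) - 1)) := by
  obtain ⟨m, rfl⟩ := Nat.exists_eq_add_of_le' hm
  have key : ∀ y : ℕ, conn (m+1) (y+1) * (1 / (2 * ((y : ℝ) + 1))) =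
      conn (m+1) y * (1 / (2 * (m : ℝ) + 1)) - conn (m+1) (y+1) * (1 / (2 * (m : ℝ) + 1)) := by
    intro y
    rw [conn_succ]
    push_cast
    field_simp
    ring
  have := tele (fun y => conn (m+1) y * (1 / (2 * (m : ℝ) + 1))) (fun y => by
    have h := key y
    have : 0 < conn (m+1) (y+1) * (1 / (2 * ((y : ℝ) + 1))) :=
      mul_pos (conn_pos _ _) (by positivity)
    show conn (m+1) (y+1) * (1 / (2 * (m : ℝ) + 1)) ≤ conn (m+1) y * (1 / (2 * (m : ℝ) + 1))
    linarith) (by simpa using (conn_tendsto_right m).mul_const (1 / (2 * (m : ℝ) + 1)))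
  simp only [key]
  rw [this, conn_zero]
  congr 1
  push_cast
  rw [one_mul]; congr 1; ring

lemma sumB (b y : ℕ) :
    ∑' m : ℕ, (if b < m then ENNReal.ofReal (1 / (2 * (m : ℝ) - 1)) *
        ENNReal.ofReal (conn m (y+1)) else 0) =
      ENNReal.ofReal (conn b (y+1)) * ENNReal.ofReal (1 / (2 * ((y : ℝ) + 1))) := by
  have hinj : Function.Injective (fun i : ℕ => b + 1 + i) := fun i j h => by simpa using h
  rw [← hinj.tsum_eq]
  swap
  · intro m hm
    have : b < m := by
      by_contra h
      simp [h] at hm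
    exact ⟨m - (b+1), by simp; omega⟩
  have key : ∀ m : ℕ, 1 / (2 * ((m+1 : ℕ) : ℝ) - 1) * conn (m+1) (y+1) =
      conn m (y+1) * (1 / (2 * ((y : ℝ) + 1))) - conn (m+1) (y+1) * (1 / (2 * ((y : ℝ) + 1))) := by
    intro m
    rw [conn_succ_left]
    push_cast
    have : 2 * ((m:ℝ)+1) - 1 = 2 * m + 1 := by ring
    rw [this]
    field_simp
    ring
  have := tele (fun i => conn (b+i) (y+1) * (1 / (2 * ((y : ℝ) + 1)))) (fun i => by
    have h := key (b+i)
    have : 0 < 1 / (2 * ((b+i+1 : ℕ) : ℝ) - 1) * conn (b+i+1) (y+1) := by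
      refine mul_pos (one_div_pos.2 ?_) (conn_pos _ _)
      push_cast
      have : (0:ℝ) ≤ b + i := by positivity
      linarith
    show conn (b+i+1) (y+1) * (1 / (2 * ((y : ℝ) + 1))) ≤ conn (b+i) (y+1) * (1 / (2 * ((y : ℝ) + 1)))
    linarith) (by
      have h := (conn_tendsto_left y).comp (Filter.tendsto_add_atTop_nat b)
      have h2 := h.mul_const (1 / (2 * ((y : ℝ) + 1)))
      simpa [Function.comp_def, add_comm] using h2)
  rw [← ENNReal.ofReal_mul (conn_pos _ _).le]
  refine Eq.trans (tsum_congr fun i => ?_) this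
  rw [if_pos (by omega), ← ENNReal.ofReal_mul, show b + 1 + i = b + i + 1 by omega, key]
  · rfl
  · apply one_div_nonneg.2
    push_cast
    have : (0:ℝ) ≤ b + i := by positivity
    linarith

open Classical in
lemma sumG (y q b : ℕ) :
    ∑' f : Fin q → ℕ, (if StrictMono f ∧ ∀ j, b < f j then
      (∏ j, ENNReal.ofReal (1 / (2 * (f j : ℝ) - 1))) *
        ENNReal.ofReal (conn ((Fin.cons b f : Fin (q+1) → ℕ) (Fin.last q)) (y+1)) else 0) =
      ENNReal.ofReal (conn b (y+1)) * ENNReal.ofReal (1 / (2 * ((y : ℝ) + 1))) ^ q := by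
  induction q generalizing b with
  | zero =>
    rw [tsum_eq_single default (fun f hf => absurd (Subsingleton.elim _ _) hf)]
    have h : StrictMono (default : Fin 0 → ℕ) := Subsingleton.strictMono _
    rw [if_pos ⟨h, fun j => j.elim0⟩]
    simp
  | succ q ih =>
    rw [← (Fin.consEquiv (fun _ => ℕ)).tsum_eq, ENNReal.tsum_prod', pow_succ', ← mul_assoc,
      ← sumB, ← ENNReal.tsum_mul_right]
    refine tsum_congr fun n => ?_
    by_cases hn : b < n
    · rw [if_pos hn, mul_assoc, ← ih n, ← ENNReal.tsum_mul_left]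
      refine tsum_congr fun f => ?_
      have hiff : (StrictMono (Fin.cons n f : Fin (q+1) → ℕ) ∧
          ∀ j, b < (Fin.cons n f : Fin (q+1) → ℕ) j) ↔ (StrictMono f ∧ ∀ j, n < f j) := by
        constructor
        · rintro ⟨h, -⟩
          refine ⟨fun i j hij => ?_, fun j => ?_⟩
          · simpa using h (Fin.succ_lt_succ_iff.2 hij)
          · simpa using h (Fin.succ_pos j)
        · rintro ⟨h, h2⟩
          refine ⟨fun i j => ?_, fun j => ?_⟩
          · refine Fin.cases ?_ (fun i => ?_) i <;> refine Fin.cases ?_ (fun j => ?_) j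
            · simp
            · intro _; simpa using h2 j
            · simp
            · intro hij; simpa using h (Fin.succ_lt_succ_iff.1 hij)
          · refine Fin.cases ?_ (fun j => ?_) j
            · simpa using hn
            · simpa using hn.trans (h2 j)
      change (if StrictMono (Fin.cons n f : Fin (q+1) → ℕ) ∧
          ∀ j, b < (Fin.cons n f : Fin (q+1) → ℕ) j then
        (∏ j, ENNReal.ofReal (1 / (2 * ((Fin.cons n f : Fin (q+1) → ℕ) j : ℝ) - 1))) *
        ENNReal.ofReal (conn ((Fin.cons b (Fin.cons n f : Fin (q+1) → ℕ) : Fin (q+2) → ℕ)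
          (Fin.last (q+1))) (y+1)) else 0) = _
      simp only [hiff, mul_ite, mul_zero]
      congr 1
      rw [Fin.prod_univ_succ, ← Fin.succ_last]
      simp only [Fin.cons_succ, Fin.cons_zero]
      rw [mul_assoc]
    · rw [if_neg hn, zero_mul, ENNReal.tsum_eq_zero]
      intro f
      rw [if_neg]
      rintro ⟨-, h⟩
      exact hn (by simpa using h 0)

lemma conn_base (y : ℕ) : conn 0 y = 2 ^ (2 * y) / (Nat.choose (2 * y) y : ℝ) := by
  induction y with
  | zero => simp [conn_zero]
  | succ y ih =>
    have h := Nat.succ_mul_centralBinom_succ y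
    rw [Nat.centralBinom_eq_two_mul_choose, Nat.centralBinom_eq_two_mul_choose] at h
    have h' : ((y : ℝ) + 1) * (Nat.choose (2 * (y+1)) (y+1)) =
      2 * (2 * y + 1) * Nat.choose (2*y) y := by exact_mod_cast h
    have p1 : (0:ℝ) < Nat.choose (2*y) y := by exact_mod_cast Nat.choose_pos (by omega)
    have p2 : (0:ℝ) < Nat.choose (2*(y+1)) (y+1) := by exact_mod_cast Nat.choose_pos (by omega)
    rw [conn_succ, ih, div_mul_div_comm, div_eq_div_iff (by positivity) (by positivity)]
    rw [show 2 * (y+1) = 2 * y + 2 by ring] at *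
    rw [pow_add]
    push_cast
    linear_combination 2 * 2 ^ (2*y) * h'

theorem sum_central_binom_eq_multipleT (q : ℕ) (hq : 0 < q) :
    ∑' n : ℕ, (2 : ℝ) ^ (2 * (n + 1)) /
        ((Nat.choose (2 * (n + 1)) (n + 1)) * (2 * ((n : ℝ) + 1)) ^ (q + 1)) =
      multipleT q (fun j => if (j : ℕ) = q - 1 then 2 else 1) := by
  classical
  obtain ⟨p, rfl⟩ := Nat.exists_eq_add_of_le' hq
  have hpos : ∀ m : ℕ, 1 ≤ m → 0 < 1 / (2 * (m : ℝ) - 1) := fun m hm => by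
    have : (1:ℝ) ≤ m := by exact_mod_cast hm
    apply one_div_pos.2; linarith
  have L : ∀ n : ℕ, (2 : ℝ) ^ (2 * (n + 1)) /
        ((Nat.choose (2 * (n + 1)) (n + 1)) * (2 * ((n : ℝ) + 1)) ^ (p + 1 + 1)) =
      (ENNReal.ofReal (conn 0 (n+1)) * ENNReal.ofReal (1 / (2 * ((n : ℝ) + 1))) ^ (p+1) *
        ENNReal.ofReal (1 / (2 * ((n : ℝ) + 1)))).toReal := by
    intro n
    rw [ENNReal.toReal_mul, ENNReal.toReal_mul, ENNReal.toReal_pow,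
      ENNReal.toReal_ofReal (conn_pos _ _).le, ENNReal.toReal_ofReal (by positivity), conn_base]
    rw [mul_assoc, ← pow_succ, div_pow, one_pow, div_mul_div_comm, mul_one]
  have R : ∀ f : {f : Fin (p+1) → ℕ // StrictMono f ∧ ∀ j, 1 ≤ f j},
      (∏ j, 1 / (2 * (f.1 j : ℝ) - 1) ^ (if (j : ℕ) = p + 1 - 1 then 2 else 1)) =
      ((∏ j, ENNReal.ofReal (1 / (2 * (f.1 j : ℝ) - 1))) *
        ENNReal.ofReal (1 / (2 * (f.1 (Fin.last p) : ℝ) - 1))).toReal := by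
    intro f
    rw [ENNReal.toReal_mul, ENNReal.toReal_prod, ENNReal.toReal_ofReal (hpos _ (f.2.2 _)).le]
    simp only [ENNReal.toReal_ofReal (hpos _ (f.2.2 _)).le]
    rw [Fin.prod_univ_castSucc, Fin.prod_univ_castSucc, mul_assoc]
    congr 1
    · refine Finset.prod_congr rfl fun j _ => ?_
      rw [if_neg (by simp; omega), pow_one]
    · rw [if_pos (by simp), ← sq, div_pow, one_pow]
  unfold multipleT
  simp only [L, R]
  have hfin : ∀ f : {f : Fin (p+1) → ℕ // StrictMono f ∧ ∀ j, 1 ≤ f j},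
      (∏ j, ENNReal.ofReal (1 / (2 * (f.1 j : ℝ) - 1))) *
        ENNReal.ofReal (1 / (2 * (f.1 (Fin.last p) : ℝ) - 1)) ≠ ⊤ := fun f =>
    ENNReal.mul_ne_top (ENNReal.prod_ne_top fun _ _ => ENNReal.ofReal_ne_top) ENNReal.ofReal_ne_top
  rw [← ENNReal.tsum_toReal_eq hfin, ← ENNReal.tsum_toReal_eq (fun n =>
    ENNReal.mul_ne_top (ENNReal.mul_ne_top ENNReal.ofReal_ne_top
      (ENNReal.pow_ne_top ENNReal.ofReal_ne_top)) ENNReal.ofReal_ne_top)]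
  congr 1
  simp only [← sumG, ← ENNReal.tsum_mul_right]
  rw [ENNReal.tsum_comm]
  have hsub := tsum_subtype {f : Fin (p+1) → ℕ | StrictMono f ∧ ∀ j, 1 ≤ f j}
    (fun f => (∏ j, ENNReal.ofReal (1 / (2 * (f j : ℝ) - 1))) *
        ENNReal.ofReal (1 / (2 * (f (Fin.last p) : ℝ) - 1)))
  refine Eq.trans (tsum_congr fun f => ?_) hsub.symm
  by_cases hf : StrictMono f ∧ ∀ j, 1 ≤ f j
  · rw [Set.indicator_of_mem (show f ∈ {f : Fin (p+1) → ℕ | StrictMono f ∧ ∀ j, 1 ≤ f j} from hf),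
      ← sumA _ (hf.2 _), ← ENNReal.tsum_mul_left]
    refine tsum_congr fun y => ?_
    have hf' : StrictMono f ∧ ∀ j, 0 < f j := hf
    rw [if_pos hf', ENNReal.ofReal_mul (conn_pos _ _).le, ← Fin.succ_last, Fin.cons_succ, mul_assoc]
  · rw [Set.indicator_of_notMem (show f ∉ {f : Fin (p+1) → ℕ | StrictMono f ∧ ∀ j, 1 ≤ f j} from hf),
      ENNReal.tsum_eq_zero]
    intro y
    have hf' : ¬ (StrictMono f ∧ ∀ j, 0 < f j) := hf
    rw [if_neg hf', zero_mul]
end
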